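/- For every integer k ≥ 2, every g ∈ H̃⁰_Γ(k), and every w ∈ 𝔹ⁿ, the inner product satisfies (g, Θ_w^{(k)}) = g(w). -/

import Mathlib

open scoped BigOperators
open Complex MeasureTheory Filter Topology Matrix

namespace BallPaper

noncomputable section

variable {n : ℕ}

/-- The unit ball in ℂⁿ. -/
def ball (n : ℕ) : Set (Fin n → ℂ) := {z | ∑ i, ‖z i‖ ^ 2 < 1}

/-- ⟨z,w⟩ = z₁ conj w₁ + ... + zₙ conj wₙ − 1. -/
def pair (z w : Fin n → ℂ) : ℂ := ∑ i, z i * star (w i) - 1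

/-- The Hermitian form of signature (n,1) on ℂ^{n+1}:
⟨⟨u,v⟩⟩ = u₁ conj v₁ + ... + uₙ conj vₙ − u_{n+1} conj v_{n+1}. -/
def herm (u v : Fin (n + 1) → ℂ) : ℂ :=
  ∑ i : Fin n, u i.castSucc * star (v i.castSucc) - u (Fin.last n) * star (v (Fin.last n))

/-- SU(n,1): determinant-one matrices preserving the (n,1) Hermitian form. -/
def SU (n : ℕ) : Set (Matrix (Fin (n + 1)) (Fin (n + 1)) ℂ) :=
  {A | A.det = 1 ∧ ∀ u v, herm (A.mulVec u) (A.mulVec v) = herm u v}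

/-- The denominator a_{n+1,1} z₁ + ... + a_{n+1,n} zₙ + a_{n+1,n+1} of the
fractional-linear action. -/
def denom (A : Matrix (Fin (n + 1)) (Fin (n + 1)) ℂ) (z : Fin n → ℂ) : ℂ :=
  ∑ j : Fin n, A (Fin.last n) j.castSucc * z j + A (Fin.last n) (Fin.last n)

/-- The fractional-linear action of a matrix on ℂⁿ (defined on the ball). -/
def act (A : Matrix (Fin (n + 1)) (Fin (n + 1)) ℂ) (z : Fin n → ℂ) : Fin n → ℂ :=
  fun j => (∑ l : Fin n, A j.castSucc l.castSucc * z l + A j.castSucc (Fin.last n)) / denom A z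

/-- The complex Jacobian J(A,z) = (denominator)^{-(n+1)}. -/
def jac (A : Matrix (Fin (n + 1)) (Fin (n + 1)) ℂ) (z : Fin n → ℂ) : ℂ :=
  (denom A z)⁻¹ ^ (n + 1)

/-- The Bergman kernel K(z,w) = (n!/πⁿ) (−⟨z,w⟩)^{−(n+1)}. -/
def Kc (z w : Fin n → ℂ) : ℂ :=
  (((Nat.factorial n : ℝ) / Real.pi ^ n : ℝ) : ℂ) * (-(pair z w))⁻¹ ^ (n + 1)

/-- K(z,z) as a real-valued function: K(z,z) = (n!/πⁿ) (1−|z|²)^{−(n+1)}. -/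
def Kr (z : Fin n → ℂ) : ℝ :=
  (Nat.factorial n : ℝ) / Real.pi ^ n * ((1 - ∑ i, ‖z i‖ ^ 2)⁻¹) ^ (n + 1)

/-- c(𝔹ⁿ,k) = C((n+1)(k−1)+n, n). -/
def cB (n k : ℕ) : ℕ := Nat.choose ((n + 1) * (k - 1) + n) n

/-- The last index of Fin n. -/
def lastI (n : ℕ) (hn : 0 < n) : Fin n := ⟨n - 1, by omega⟩

/-- The geodesic C̃₀ = {z ∈ 𝔹ⁿ : z₁ = ... = z_{n−1} = 0, zₙ ∈ (−1,1) real}. -/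
def geo0 (n : ℕ) (hn : 0 < n) : Set (Fin n → ℂ) :=
  {z | (∀ i : Fin n, (i : ℕ) < n - 1 → z i = 0) ∧ (z (lastI n hn)).im = 0 ∧
    -1 < (z (lastI n hn)).re ∧ (z (lastI n hn)).re < 1}

/-- The point (0,...,0,x) of C̃₀. -/
def curve (n : ℕ) (hn : 0 < n) (x : ℝ) : Fin n → ℂ :=
  fun i => if i = lastI n hn then (x : ℂ) else 0

/-- The vector (X,1) ∈ ℂ^{n+1}. -/
def snoc1 (X : Fin n → ℂ) : Fin (n + 1) → ℂ := Fin.snoc X 1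

/-- The matrix A_γ, with columns v₁,...,v_{n−1},
⟨X,Y⟩⁻¹(X,1) + (1/2)(Y,1), ⟨X,Y⟩⁻¹(X,1) − (1/2)(Y,1). -/
def Amat (n : ℕ) (v : Fin (n - 1) → Fin (n + 1) → ℂ) (X Y : Fin n → ℂ) :
    Matrix (Fin (n + 1)) (Fin (n + 1)) ℂ :=
  Matrix.of fun i j =>
    if h : (j : ℕ) < n - 1 then v ⟨j, h⟩ i
    else if (j : ℕ) = n - 1 then ((pair X Y)⁻¹ • snoc1 X + (2 : ℂ)⁻¹ • snoc1 Y) i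
    else ((pair X Y)⁻¹ • snoc1 X - (2 : ℂ)⁻¹ • snoc1 Y) i

/-- σ = diag(1,...,1,−1). -/
def sigmaM (n : ℕ) : Matrix (Fin (n + 1)) (Fin (n + 1)) ℂ :=
  Matrix.diagonal fun i => if i = Fin.last n then -1 else 1

/-- Inverse hyperbolic cosine. -/
def arcosh (x : ℝ) : ℝ := Real.log (x + Real.sqrt (x ^ 2 - 1))

/-- Inverse hyperbolic tangent. -/
def artanh (x : ℝ) : ℝ := Real.log ((1 + x) / (1 - x)) / 2

/-- The hyperbolic (Bergman) distance on the ball, determined by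
cosh²(ρ(z,w)/2) = ⟨z,w⟩⟨w,z⟩/(⟨z,z⟩⟨w,w⟩). -/
def rho (z w : Fin n → ℂ) : ℝ :=
  2 * arcosh (Real.sqrt ((pair z w * pair w z).re / (pair z z * pair w w).re))

/-- A discrete subgroup Γ of SU(n,1) acting freely on the ball with compact quotient. -/
structure DiscreteGroup (n : ℕ) where
  Γ : Set (Matrix (Fin (n + 1)) (Fin (n + 1)) ℂ)
  sub_SU : Γ ⊆ SU n
  one_mem : 1 ∈ Γ
  mul_mem : ∀ {A B}, A ∈ Γ → B ∈ Γ → A * B ∈ Γ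
  inv_mem : ∀ {A}, A ∈ Γ → A⁻¹ ∈ Γ
  discrete : DiscreteTopology ↥Γ
  free : ∀ A ∈ Γ, (∃ z ∈ ball n, act A z = z) → A = 1
  cocompact : ∃ F : Set (Fin n → ℂ), F ⊆ ball n ∧ IsCompact F ∧
    ∀ z ∈ ball n, ∃ A ∈ Γ, act A z ∈ F

/-- A hyperbolic element γ of Γ, with real eigenvalues, real fixed points X, Y on the
boundary, eigenvalue data λ, and the eigenvectors v₁,...,v_{n−1} for eigenvalues ±1,
orthonormal with respect to the form ⟨⟨.,.⟩⟩. -/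
structure HypElt (n : ℕ) (G : DiscreteGroup n) where
  γ : Matrix (Fin (n + 1)) (Fin (n + 1)) ℂ
  mem : γ ∈ G.Γ
  ne_one : γ ≠ 1
  eig_real : ∀ μ ∈ spectrum ℂ γ, μ.im = 0
  X : Fin n → ℂ
  Y : Fin n → ℂ
  X_bd : ∑ i, ‖X i‖ ^ 2 = 1
  Y_bd : ∑ i, ‖Y i‖ ^ 2 = 1
  X_real : ∀ i, (X i).im = 0
  Y_real : ∀ i, (Y i).im = 0
  lam : ℝ
  lam_sq : 1 < lam ^ 2
  eigX : γ.mulVec (snoc1 X) = (lam : ℂ) • snoc1 X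
  eigY : γ.mulVec (snoc1 Y) = ((lam : ℂ))⁻¹ • snoc1 Y
  primitive : ∀ A ∈ G.Γ, ∀ m : ℕ, 2 ≤ m → A ^ m ≠ γ
  v : Fin (n - 1) → Fin (n + 1) → ℂ
  alph : Fin (n - 1) → ℂ
  alph_pm : ∀ j, alph j = 1 ∨ alph j = -1
  v_eig : ∀ j, γ.mulVec (v j) = alph j • v j
  v_on : ∀ j l, herm (v j) (v l) = if j = l then 1 else 0

variable {G : DiscreteGroup n}

/-- The matrix A_γ associated to the hyperbolic element γ. -/
def HypElt.A (H : HypElt n G) : Matrix (Fin (n + 1)) (Fin (n + 1)) ℂ :=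
  Amat n H.v H.X H.Y

/-- γ₀ = A_γ⁻¹ γ A_γ. -/
def HypElt.g0 (H : HypElt n G) : Matrix (Fin (n + 1)) (Fin (n + 1)) ℂ :=
  (H.A)⁻¹ * H.γ * H.A

/-- T = (λ²−1)/(λ²+1), the last coordinate of γ₀(0). -/
def HypElt.T (H : HypElt n G) : ℝ := (H.lam ^ 2 - 1) / (H.lam ^ 2 + 1)

/-- The geodesic C̃ in 𝔹ⁿ with endpoints X, Y, as the image of C̃₀ under A_γ. -/
def HypElt.Ct (H : HypElt n G) (hn : 0 < n) : Set (Fin n → ℂ) :=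
  act H.A '' geo0 n hn

/-- The length l(C) of the closed geodesic C, the hyperbolic distance from 0 to γ₀(0). -/
def HypElt.lenC (H : HypElt n G) : ℝ :=
  rho (0 : Fin n → ℂ) (act H.g0 (0 : Fin n → ℂ))

/-- A (measure-theoretic) fundamental domain for the action of Γ on the ball. -/
def IsFundDom (G : DiscreteGroup n) (F : Set (Fin n → ℂ)) : Prop :=
  F ⊆ ball n ∧ MeasurableSet F ∧ (∀ z ∈ ball n, ∃ A ∈ G.Γ, act A z ∈ F) ∧
    ∀ A ∈ G.Γ, A ≠ 1 → volume {z ∈ F | act A z ∈ F} = 0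

/-- The automorphy condition f(Az) J(A,z)^k = f(z). -/
def Automorphic (G : DiscreteGroup n) (k : ℕ) (f : (Fin n → ℂ) → ℂ) : Prop :=
  ∀ A ∈ G.Γ, ∀ z ∈ ball n, f (act A z) * jac A z ^ k = f z

/-- Membership in H̃⁰_Γ(k): holomorphic on the ball and automorphic of weight k. -/
def Htilde (G : DiscreteGroup n) (k : ℕ) (f : (Fin n → ℂ) → ℂ) : Prop :=
  DifferentiableOn ℂ f (ball n) ∧ Automorphic G k f

/-- The inner product (f,g) = ∫_M f ḡ K(z,z)^{−k} dV = ∫_F f ḡ K(z,z)^{1−k} dV_e,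
computed over a fundamental domain F. -/
def iprod (F : Set (Fin n → ℂ)) (k : ℕ) (f g : (Fin n → ℂ) → ℂ) : ℂ :=
  ∫ z in F, f z * star (g z) * ((Kr z ^ ((1 : ℤ) - (k : ℤ)) : ℝ) : ℂ)

/-- The Poincaré series Θ_w^{(k)}(z) = c(𝔹ⁿ,k) Σ_{A∈Γ} K(Az,w)^k J(A,z)^k. -/
def ThetaPt (G : DiscreteGroup n) (k : ℕ) (w z : Fin n → ℂ) : ℂ :=
  (cB n k : ℂ) * ∑' A : ↥G.Γ, Kc (act (A : Matrix (Fin (n + 1)) (Fin (n + 1)) ℂ) z) w ^ k *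
    jac (A : Matrix (Fin (n + 1)) (Fin (n + 1)) ℂ) z ^ k

/-- The relative Poincaré series
Θ_C^{(k)}(z) = ∫_C Θ_w^{(k)}(z) K(w,w)^{−k/2} ((A_γ⁻¹)*φ)(w), written out over one
period of C̃, parametrized by w = A_γ(0,...,0,x), x ∈ [0,T]. -/
def ThetaC (hn : 0 < n) (H : HypElt n G) (k : ℕ) (z : Fin n → ℂ) : ℂ :=
  ∫ x in (0 : ℝ)..H.T, ThetaPt G k (act H.A (curve n hn x)) z *
    ((Kr (act H.A (curve n hn x)) ^ (-(k : ℝ) / 2) : ℝ) : ℂ) *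
    ((Kr (curve n hn x) ^ (((n : ℝ) + 1))⁻¹ : ℝ) : ℂ)

/-- The set of integer powers of a matrix. -/
def zpows (g : Matrix (Fin (n + 1)) (Fin (n + 1)) ℂ) :
    Set (Matrix (Fin (n + 1)) (Fin (n + 1)) ℂ) := {h | ∃ m : ℤ, h = g ^ m}

/-- The conjugate group A_γ⁻¹ Γ A_γ. -/
def conjGrp (G : DiscreteGroup n) (H : HypElt n G) :
    Set (Matrix (Fin (n + 1)) (Fin (n + 1)) ℂ) :=
  (fun g => (H.A)⁻¹ * g * H.A) '' G.Γ

end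

end BallPaper

namespace BallPaper

/-- The matrices preserving the Hermitian form, with determinant of modulus one. -/
structure IsPseudoUnitary {n : ℕ} (A : Matrix (Fin (n + 1)) (Fin (n + 1)) ℂ) : Prop where
  norm_det : ‖A.det‖ = 1
  herm_mulVec : ∀ u v, herm (A.mulVec u) (A.mulVec v) = herm u v

variable {n : ℕ} {A B : Matrix (Fin (n + 1)) (Fin (n + 1)) ℂ} {z w : Fin n → ℂ}

theorem isPseudoUnitary_of_mem_SU (h : A ∈ SU n) : IsPseudoUnitary A :=
  ⟨by rw [h.1]; simp, h.2⟩

theorem IsPseudoUnitary.isUnit_det (h : IsPseudoUnitary A) : IsUnit A.det := by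
  rw [isUnit_iff_ne_zero]
  intro h0
  have := h.norm_det
  simp [h0] at this

theorem IsPseudoUnitary.inv (h : IsPseudoUnitary A) : IsPseudoUnitary A⁻¹ := by
  refine ⟨?_, fun u v => ?_⟩
  · rw [Matrix.det_nonsing_inv, Ring.inverse_eq_inv', norm_inv, h.norm_det, inv_one]
  · rw [← h.herm_mulVec, Matrix.mulVec_mulVec, Matrix.mulVec_mulVec,
      Matrix.mul_nonsing_inv _ h.isUnit_det, Matrix.one_mulVec, Matrix.one_mulVec]

@[simp] theorem snoc1_last (z : Fin n → ℂ) : snoc1 z (Fin.last n) = 1 := by simp [snoc1]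

@[simp] theorem snoc1_castSucc (z : Fin n → ℂ) (i : Fin n) : snoc1 z i.castSucc = z i := by
  simp [snoc1]

theorem denom_eq (A : Matrix (Fin (n + 1)) (Fin (n + 1)) ℂ) (z : Fin n → ℂ) :
    denom A z = A.mulVec (snoc1 z) (Fin.last n) := by
  simp [denom, Matrix.mulVec, dotProduct, Fin.sum_univ_castSucc]

theorem act_eq (A : Matrix (Fin (n + 1)) (Fin (n + 1)) ℂ) (z : Fin n → ℂ) (j : Fin n) :
    act A z j = A.mulVec (snoc1 z) j.castSucc / denom A z := by
  simp [act, Matrix.mulVec, dotProduct, Fin.sum_univ_castSucc]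

theorem mulVec_snoc1 (h : denom A z ≠ 0) :
    A.mulVec (snoc1 z) = denom A z • snoc1 (act A z) := by
  ext i
  refine Fin.lastCases ?_ (fun j => ?_) i
  · simp [denom_eq]
  · simp [act_eq, mul_div_cancel₀ _ h]

theorem herm_snoc1 (z w : Fin n → ℂ) : herm (snoc1 z) (snoc1 w) = pair z w := by
  simp [herm, pair]

theorem herm_smul_smul (a b : ℂ) (u v : Fin (n + 1) → ℂ) :
    herm (a • u) (b • v) = a * star b * herm u v := by
  simp only [herm, Pi.smul_apply, smul_eq_mul, star_mul', mul_sub, Finset.mul_sum]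
  congr 1
  · exact Finset.sum_congr rfl fun i _ => by ring
  · ring

theorem pair_self (z : Fin n → ℂ) : pair z z = ((∑ i, ‖z i‖ ^ 2 - 1 : ℝ) : ℂ) := by
  simp [pair, Complex.mul_conj, Complex.normSq_eq_norm_sq]

theorem denom_ne_zero (h : IsPseudoUnitary A) (hz : z ∈ ball n) : denom A z ≠ 0 := by
  intro h0
  have h1 := h.herm_mulVec (snoc1 z) (snoc1 z)
  rw [herm_snoc1, pair_self, herm, ← denom_eq, h0] at h1
  have h2 : (0 : ℝ) ≤ ∑ i, ‖z i‖ ^ 2 - 1 := by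
    have h3 : ((∑ i : Fin n, ‖A.mulVec (snoc1 z) i.castSucc‖ ^ 2 : ℝ) : ℂ)
        = ((∑ i, ‖z i‖ ^ 2 - 1 : ℝ) : ℂ) := by
      rw [← h1]
      simp [Complex.mul_conj, Complex.normSq_eq_norm_sq]
    rw [← Complex.ofReal_injective h3]
    positivity
  have h4 : ∑ i, ‖z i‖ ^ 2 < 1 := hz
  linarith

theorem pair_act (h : IsPseudoUnitary A) (hz : z ∈ ball n) (hw : w ∈ ball n) :
    denom A z * star (denom A w) * pair (act A z) (act A w) = pair z w := by
  rw [← herm_snoc1, ← herm_snoc1 z, ← h.herm_mulVec (snoc1 z), mulVec_snoc1 (denom_ne_zero h hz),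
    mulVec_snoc1 (denom_ne_zero h hw), herm_smul_smul]

theorem one_sub_act (h : IsPseudoUnitary A) (hz : z ∈ ball n) :
    ‖denom A z‖ ^ 2 * (1 - ∑ i, ‖act A z i‖ ^ 2) = 1 - ∑ i, ‖z i‖ ^ 2 := by
  have h1 := pair_act h hz hz
  rw [pair_self, pair_self, Complex.star_def, Complex.mul_conj, Complex.normSq_eq_norm_sq] at h1
  have h2 := Complex.ofReal_injective (by rw [← h1]; push_cast; rfl :
    ((‖denom A z‖ ^ 2 * (∑ i, ‖act A z i‖ ^ 2 - 1) : ℝ) : ℂ) = _)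
  linarith

theorem act_mem_ball (h : IsPseudoUnitary A) (hz : z ∈ ball n) : act A z ∈ ball n := by
  have h1 := one_sub_act h hz
  have h2 : ∑ i, ‖z i‖ ^ 2 < 1 := hz
  have h3 : 0 < 1 - ∑ i, ‖act A z i‖ ^ 2 := by
    refine pos_of_mul_pos_right (a := ‖denom A z‖ ^ 2) ?_ (by positivity)
    linarith
  change ∑ i, ‖act A z i‖ ^ 2 < 1
  linarith

theorem act_one (z : Fin n → ℂ) : act 1 z = z := by
  ext j
  simp [act_eq, denom_eq]

theorem act_mul (hB : IsPseudoUnitary B) (hz : z ∈ ball n) :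
    act (A * B) z = act A (act B z) := by
  have h1 : (A * B).mulVec (snoc1 z) = denom B z • A.mulVec (snoc1 (act B z)) := by
    rw [← Matrix.mulVec_mulVec, mulVec_snoc1 (denom_ne_zero hB hz), Matrix.mulVec_smul]
  ext j
  rw [act_eq, act_eq, denom_eq, denom_eq, h1, Pi.smul_apply, Pi.smul_apply, smul_eq_mul,
    smul_eq_mul, mul_div_mul_left _ _ (denom_ne_zero hB hz)]

theorem act_inv_act (h : IsPseudoUnitary A) (hz : z ∈ ball n) : act A⁻¹ (act A z) = z := by
  rw [← act_mul h hz, Matrix.nonsing_inv_mul _ h.isUnit_det, act_one]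

theorem act_act_inv (h : IsPseudoUnitary A) (hz : z ∈ ball n) : act A (act A⁻¹ z) = z := by
  rw [← act_mul h.inv hz, Matrix.mul_nonsing_inv _ h.isUnit_det, act_one]

theorem injOn_act (h : IsPseudoUnitary A) : Set.InjOn (act A) (ball n) := fun x hx y hy hxy => by
  rw [← act_inv_act h hx, hxy, act_inv_act h hy]

theorem image_act_ball (h : IsPseudoUnitary A) : act A '' ball n = ball n := by
  apply Set.Subset.antisymm
  · rintro _ ⟨z, hz, rfl⟩
    exact act_mem_ball h hz
  · exact fun z hz => ⟨act A⁻¹ z, act_mem_ball h.inv hz, act_act_inv h hz⟩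

theorem zero_mem_ball : (0 : Fin n → ℂ) ∈ ball n := by simp [ball]

/-- The group of automorphisms of the ball is transitive: the reflection in a negative vector
exchanges the lines over `0` and over `w`. -/
theorem exists_act_zero_eq (hw : w ∈ ball n) :
    ∃ A : Matrix (Fin (n + 1)) (Fin (n + 1)) ℂ, IsPseudoUnitary A ∧ act A 0 = w := by
  have hw' : 0 < 1 - ∑ i, ‖w i‖ ^ 2 := sub_pos.2 hw
  set c : ℝ := (√(1 - ∑ i, ‖w i‖ ^ 2))⁻¹ with hc
  have hc0 : 0 < c := inv_pos.2 (Real.sqrt_pos.2 hw')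
  have hc2 : c ^ 2 * (1 - ∑ i, ‖w i‖ ^ 2) = 1 := by
    rw [hc, inv_pow, Real.sq_sqrt hw'.le, inv_mul_cancel₀ hw'.ne']
  let v : Fin (n + 1) → ℂ := Fin.snoc (fun i => (c : ℂ) * w i) (c + 1 : ℂ)
  let v' : Fin (n + 1) → ℂ := Fin.snoc (fun i => (c : ℂ) * star (w i)) (-(c + 1) : ℂ)
  have hvl : v (Fin.last n) = c + 1 := by simp [v]
  have hvl' : v' (Fin.last n) = -(c + 1) := by simp [v']
  have hvc (i : Fin n) : v i.castSucc = c * w i := by simp [v]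
  have hvc' (i : Fin n) : v' i.castSucc = c * star (w i) := by simp [v']
  have hherm (u) : herm u v = v' ⬝ᵥ u := by
    simp only [herm, dotProduct, Fin.sum_univ_castSucc, hvl, hvl', hvc, hvc']
    simp only [star_mul', Complex.star_def, Complex.conj_ofReal, map_add, map_one]
    rw [sub_eq_add_neg]
    congr 1
    · exact Finset.sum_congr rfl fun i _ => by ring
    · ring
  have hherm' (u) : herm v u = star (v' ⬝ᵥ u) := by
    rw [← hherm]
    simp [herm, mul_comm]
  have hvv : v' ⬝ᵥ v = -2 * (c + 1) := by
    simp only [dotProduct, Fin.sum_univ_castSucc, hvl, hvl', hvc, hvc']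
    have h1 : ∑ i, (c : ℂ) * star (w i) * (c * w i) = ((c ^ 2 * ∑ i, ‖w i‖ ^ 2 : ℝ) : ℂ) := by
      push_cast
      rw [Finset.mul_sum]
      refine Finset.sum_congr rfl fun i _ => ?_
      rw [← Complex.ofReal_pow ‖w i‖, ← Complex.normSq_eq_norm_sq, ← Complex.mul_conj,
        Complex.star_def]
      ring
    have h2 : c ^ 2 * ∑ i, ‖w i‖ ^ 2 = c ^ 2 - 1 := by linarith
    rw [h1, h2]
    push_cast
    ring
  have hc1 : (c + 1 : ℂ) ≠ 0 := by exact_mod_cast (by positivity : c + 1 ≠ 0)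
  let A : Matrix (Fin (n + 1)) (Fin (n + 1)) ℂ := 1 + Matrix.vecMulVec ((c + 1 : ℂ)⁻¹ • v) v'
  have hA (u) : A.mulVec u = u + ((c + 1 : ℂ)⁻¹ * (v' ⬝ᵥ u)) • v := by
    ext i
    simp only [A, Matrix.add_mulVec, Matrix.vecMulVec_mulVec, Matrix.one_mulVec, Pi.add_apply,
      Pi.smul_apply, MulOpposite.smul_eq_mul_unop, MulOpposite.unop_op, smul_eq_mul]
    ring
  have hadd (a b x : Fin (n + 1) → ℂ) : herm (a + b) x = herm a x + herm b x := by
    simp only [herm, Pi.add_apply, add_mul, Finset.sum_add_distrib]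
    ring
  have hadd' (x a b : Fin (n + 1) → ℂ) : herm x (a + b) = herm x a + herm x b := by
    simp only [herm, Pi.add_apply, star_add, mul_add, Finset.sum_add_distrib]
    ring
  have hsm (t : ℂ) (a b : Fin (n + 1) → ℂ) : herm (t • a) b = t * herm a b := by
    simpa using herm_smul_smul t 1 a b
  have hsm' (t : ℂ) (a b : Fin (n + 1) → ℂ) : herm a (t • b) = star t * herm a b := by
    simpa using herm_smul_smul 1 t a b
  refine ⟨A, ⟨?_, fun x y => ?_⟩, ?_⟩
  · have : A.det = -1 := by
      simp only [A]
      rw [Matrix.vecMulVec_eq Unit, Matrix.det_one_add_replicateCol_mul_replicateRow,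
        dotProduct_smul, hvv, smul_eq_mul]
      field_simp
      ring
    rw [this]
    simp
  · rw [hA, hA]
    simp only [hadd, hadd', hsm, hsm', hherm, hherm', hvv]
    have hs : star (c + 1 : ℂ)⁻¹ = (c + 1 : ℂ)⁻¹ := by simp
    rw [star_mul', hs]
    field_simp
    ring
  · have h0 : v' ⬝ᵥ snoc1 0 = -(c + 1) := by
      simp [dotProduct, Fin.sum_univ_castSucc, hvl']
    have h1 : A.mulVec (snoc1 0) = snoc1 0 - v := by
      rw [hA, h0, mul_neg, inv_mul_cancel₀ hc1, neg_one_smul, sub_eq_add_neg]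
    ext j
    rw [act_eq, denom_eq, h1]
    have : (c : ℂ) ≠ 0 := by exact_mod_cast hc0.ne'
    simp [hvl, hvc]
    field_simp

theorem det_submatrix_sub (A : Matrix (Fin (n + 1)) (Fin (n + 1)) ℂ) (hd : denom A z ≠ 0) :
    denom A z * (Matrix.of fun j l : Fin n =>
      A j.castSucc l.castSucc - act A z j * A (Fin.last n) l.castSucc).det = A.det := by
  let B := A.updateCol (Fin.last n) (fun k => ∑ i, snoc1 z i • A k i)
  have hB : B.det = A.det := by
    rw [Matrix.det_updateCol_sum]
    simp
  have hBl (k) : B k (Fin.last n) = A.mulVec (snoc1 z) k := by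
    simp [B, Matrix.mulVec, dotProduct, mul_comm]
  have hBc (k) (l : Fin n) : B k l.castSucc = A k l.castSucc := by
    simp [B, Fin.castSucc_ne_last]
  let c : Fin (n + 1) → ℂ := Fin.snoc (act A z) 0
  let N : Matrix (Fin (n + 1)) (Fin (n + 1)) ℂ := Matrix.of fun i j => B i j - c i * B (Fin.last n) j
  have hcl : c (Fin.last n) = 0 := by simp [c]
  have hcc (i : Fin n) : c i.castSucc = act A z i := by simp [c]
  have hN : B.det = N.det :=
    Matrix.det_eq_of_forall_row_eq_smul_add_const c (Fin.last n) hcl fun i j => by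
      simp [N, hcl]
  have hNl : N (Fin.last n) (Fin.last n) = denom A z := by
    simp [N, hcl, hBl, denom_eq]
  have hNc (i : Fin n) : N i.castSucc (Fin.last n) = 0 := by
    simp [N, hcc, hBl, act_eq, ← denom_eq, hd]
  rw [← hB, hN, Matrix.det_succ_column N (Fin.last n), Fin.sum_univ_castSucc]
  simp only [hNc, hNl, mul_zero, zero_mul, Finset.sum_const_zero, zero_add, Fin.val_last,
    Fin.succAbove_last]
  rw [Even.neg_one_pow ⟨n, rfl⟩, one_mul]
  congr 2
  ext i j
  simp [N, hcc, hBc]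

/-- The complex derivative of the action at a point. -/
noncomputable def actDeriv (A : Matrix (Fin (n + 1)) (Fin (n + 1)) ℂ) (z : Fin n → ℂ) :
    (Fin n → ℂ) →L[ℂ] (Fin n → ℂ) :=
  (Matrix.toLin' ((denom A z)⁻¹ • Matrix.of fun j l : Fin n =>
      A j.castSucc l.castSucc - act A z j * A (Fin.last n) l.castSucc)).toContinuousLinearMap

theorem hasFDerivAt_mulVec_snoc1 (A : Matrix (Fin (n + 1)) (Fin (n + 1)) ℂ) (i : Fin (n + 1))
    (z : Fin n → ℂ) :
    HasFDerivAt (fun z => A.mulVec (snoc1 z) i)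
      (∑ l : Fin n, A i l.castSucc • ContinuousLinearMap.proj (R := ℂ) (φ := fun _ => ℂ) l) z := by
  have h := ((∑ l : Fin n, A i l.castSucc •
    ContinuousLinearMap.proj (R := ℂ) (φ := fun _ => ℂ) l).hasFDerivAt (x := z)).add_const
      (A i (Fin.last n))
  convert! h using 1
  ext z
  simp [Matrix.mulVec, dotProduct, Fin.sum_univ_castSucc]

theorem hasFDerivAt_act (hd : denom A z ≠ 0) : HasFDerivAt (act A) (actDeriv A z) z := by
  rw [hasFDerivAt_pi']
  intro j
  have h1 := hasFDerivAt_mulVec_snoc1 A j.castSucc z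
  have h2 := hasFDerivAt_mulVec_snoc1 A (Fin.last n) z
  have h3 := h1.mul ((hasDerivAt_inv (by rwa [← denom_eq])).comp_hasFDerivAt z h2)
  convert! h3 using 1
  · ext x
    simp [act_eq, denom_eq, div_eq_mul_inv]
  · ext v
    have h4 : A.mulVec (snoc1 z) j.castSucc = act A z j * denom A z := by
      rw [act_eq, div_mul_cancel₀ _ hd]
    have h5 : ∑ x, A (Fin.last n) x * snoc1 z x = denom A z := (denom_eq A z).symm
    rw [h4, ← denom_eq]
    simp only [actDeriv, ContinuousLinearMap.comp_apply,
      LinearMap.coe_toContinuousLinearMap', ContinuousLinearMap.proj_apply, Matrix.toLin'_apply,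
      Matrix.smul_mulVec, Pi.smul_apply, Matrix.mulVec, dotProduct, Matrix.of_apply, smul_eq_mul,
      _root_.add_apply, _root_.smul_apply, _root_.sum_apply,
      Function.comp_apply, sub_mul, Finset.sum_sub_distrib, mul_assoc, ← Finset.mul_sum, h5]
    field_simp
    ring

theorem abs_det_actDeriv (h : IsPseudoUnitary A) (hz : z ∈ ball n) :
    |((actDeriv A z).restrictScalars ℝ).det| = ‖jac A z‖ ^ 2 := by
  have hd := denom_ne_zero h hz
  have h1 : (actDeriv A z).det = A.det * jac A z := by
    rw [← det_submatrix_sub A hd, actDeriv, ContinuousLinearMap.det,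
      LinearMap.coe_toContinuousLinearMap, LinearMap.det_toLin', Matrix.det_smul, jac]
    simp only [Fintype.card_fin, pow_succ]
    field_simp
  have h2 : ((actDeriv A z).restrictScalars ℝ).det = Complex.normSq (actDeriv A z).det := by
    rw [ContinuousLinearMap.det, ContinuousLinearMap.det, ← Algebra.norm_complex_apply,
      ← LinearMap.det_restrictScalars]
    rfl
  rw [h2, h1, Complex.normSq_eq_norm_sq, norm_mul, h.norm_det, one_mul, abs_of_nonneg (by positivity)]

theorem isOpen_ball : IsOpen (ball n) :=
  isOpen_lt (by fun_prop) continuous_const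

theorem differentiableOn_act (h : IsPseudoUnitary A) : DifferentiableOn ℂ (act A) (ball n) :=
  fun _ hz => (hasFDerivAt_act (denom_ne_zero h hz)).differentiableAt.differentiableWithinAt

theorem hasFDerivWithinAt_act_real (h : IsPseudoUnitary A) {S : Set (Fin n → ℂ)}
    (hz : z ∈ ball n) :
    HasFDerivWithinAt (act A) ((actDeriv A z).restrictScalars ℝ) S z :=
  ((hasFDerivAt_act (denom_ne_zero h hz)).restrictScalars ℝ).hasFDerivWithinAt

theorem setIntegral_image_act (h : IsPseudoUnitary A) {S : Set (Fin n → ℂ)} (hS : S ⊆ ball n)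
    (hSm : MeasurableSet S) {E : Type*} [NormedAddCommGroup E] [NormedSpace ℝ E]
    (f : (Fin n → ℂ) → E) :
    ∫ z in act A '' S, f z = ∫ z in S, ‖jac A z‖ ^ 2 • f (act A z) := by
  rw [integral_image_eq_integral_abs_det_fderiv_smul volume hSm
    (fun z hz => hasFDerivWithinAt_act_real h (hS hz)) ((injOn_act h).mono hS)]
  exact setIntegral_congr_fun hSm fun z hz => by rw [abs_det_actDeriv h (hS hz)]

theorem integrableOn_image_act (h : IsPseudoUnitary A) {S : Set (Fin n → ℂ)} (hS : S ⊆ ball n)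
    (hSm : MeasurableSet S) {E : Type*} [NormedAddCommGroup E] [NormedSpace ℝ E]
    (f : (Fin n → ℂ) → E) :
    IntegrableOn f (act A '' S) ↔ IntegrableOn (fun z => ‖jac A z‖ ^ 2 • f (act A z)) S := by
  rw [integrableOn_image_iff_integrableOn_abs_det_fderiv_smul volume hSm
    (fun z hz => hasFDerivWithinAt_act_real h (hS hz)) ((injOn_act h).mono hS)]
  exact integrableOn_congr_fun (fun z hz => by rw [abs_det_actDeriv h (hS hz)]) hSm

theorem measurableSet_image_act (h : IsPseudoUnitary A) {S : Set (Fin n → ℂ)} (hS : S ⊆ ball n)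
    (hSm : MeasurableSet S) : MeasurableSet (act A '' S) :=
  hSm.image_of_continuousOn_injOn ((differentiableOn_act h).continuousOn.mono hS)
    ((injOn_act h).mono hS)

theorem volume_image_act_eq_zero (h : IsPseudoUnitary A) {S : Set (Fin n → ℂ)} (hS : S ⊆ ball n)
    (hS0 : volume S = 0) : volume (act A '' S) = 0 :=
  addHaar_image_eq_zero_of_differentiableOn_of_addHaar_eq_zero volume
    (fun _ hz => (hasFDerivWithinAt_act_real h (hS hz)).differentiableWithinAt) hS0

theorem volume_sum_norm_sq_lt {ι : Type*} [Fintype ι] [Nonempty ι] (t : ℝ) :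
    volume {x : ι → ℂ | ∑ i, ‖x i‖ ^ 2 < t} =
      ENNReal.ofReal t ^ Fintype.card ι *
        ENNReal.ofReal (Real.pi ^ Fintype.card ι / (Fintype.card ι).factorial) := by
  rcases le_or_gt t 0 with ht | ht
  · have : {x : ι → ℂ | ∑ i, ‖x i‖ ^ 2 < t} = ∅ := by
      ext x
      simpa using ht.trans (by positivity)
    rw [this, ENNReal.ofReal_of_nonpos ht]
    simp
  · have h1 := Complex.volume_sum_rpow_lt ι (p := 2) (by norm_num) (√t)
    have h2 : {x : ι → ℂ | (∑ i, ‖x i‖ ^ (2 : ℝ)) ^ (1 / (2 : ℝ)) < √t}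
        = {x | ∑ i, ‖x i‖ ^ 2 < t} := by
      ext x
      simp only [Set.mem_ofPred_eq, Real.rpow_two, ← Real.sqrt_eq_rpow]
      exact Real.sqrt_lt_sqrt_iff (by positivity)
    rw [← h2, h1, pow_mul, ← ENNReal.ofReal_pow (by positivity), Real.sq_sqrt ht.le]
    congr 3
    · norm_num
    · rw [mul_div_cancel_left₀ _ two_ne_zero, Real.Gamma_nat_eq_factorial]

theorem lintegral_one_sub_norm_sq_pow (n : ℕ) {a : ℕ} (ha : 0 < a) :
    ∫⁻ z : Fin n → ℂ, ENNReal.ofReal (1 - ∑ i, ‖z i‖ ^ 2) ^ a =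
      ENNReal.ofReal (Real.pi ^ n * a.factorial / (n + a).factorial) := by
  have : Nonempty (Fin a) := ⟨⟨0, ha⟩⟩
  have h1 := volume_sum_norm_sq_lt (ι := Fin n ⊕ Fin a) 1
  have hmp := volume_measurePreserving_sumPiEquivProdPi (fun _ : Fin n ⊕ Fin a => ℂ)
  let S : Set ((Fin n → ℂ) × (Fin a → ℂ)) := {p | ∑ i, ‖p.2 i‖ ^ 2 < 1 - ∑ i, ‖p.1 i‖ ^ 2}
  have hS : MeasurableSet S :=
    (isOpen_lt (by fun_prop) (by fun_prop)).measurableSet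
  have h2 : volume S = volume {x : Fin n ⊕ Fin a → ℂ | ∑ i, ‖x i‖ ^ 2 < 1} := by
    rw [← hmp.measure_preimage hS.nullMeasurableSet]
    congr 1
    ext x
    simp [S, MeasurableEquiv.sumPiEquivProdPi, Equiv.sumPiEquivProdPi, lt_sub_iff_add_lt,
      add_comm]
  have h3 : volume S = ∫⁻ z : Fin n → ℂ, ENNReal.ofReal (1 - ∑ i, ‖z i‖ ^ 2) ^ a *
      ENNReal.ofReal (Real.pi ^ a / a.factorial) := by
    rw [Measure.volume_eq_prod, Measure.prod_apply hS]
    congr 1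
    ext z
    have := volume_sum_norm_sq_lt (ι := Fin a) (1 - ∑ i, ‖z i‖ ^ 2)
    rw [Fintype.card_fin] at this
    exact this
  rw [h2, h1, lintegral_mul_const _ (by fun_prop)] at h3
  simp only [ENNReal.ofReal_one, one_pow, one_mul, Fintype.card_sum, Fintype.card_fin] at h3
  have hpos : 0 < Real.pi ^ a / a.factorial := by positivity
  have h4 : (Real.pi ^ (n + a) / (n + a).factorial)
      = Real.pi ^ n * a.factorial / (n + a).factorial * (Real.pi ^ a / a.factorial) := by
    field_simp
    rw [pow_add]
  rw [h4, ENNReal.ofReal_mul (by positivity)] at h3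
  exact ((ENNReal.mul_left_inj (ENNReal.ofReal_pos.2 hpos).ne' ENNReal.ofReal_ne_top).1 h3).symm

theorem setIntegral_ball_one_sub_norm_sq_pow (n : ℕ) {a : ℕ} (ha : 0 < a) :
    ∫ z in ball n, (1 - ∑ i, ‖z i‖ ^ 2) ^ a =
      Real.pi ^ n * a.factorial / (n + a).factorial := by
  have hb : MeasurableSet (ball n) := isOpen_ball.measurableSet
  rw [integral_eq_lintegral_of_nonneg_ae]
  · have : ∫⁻ z in ball n, ENNReal.ofReal ((1 - ∑ i, ‖z i‖ ^ 2) ^ a)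
        = ∫⁻ z : Fin n → ℂ, ENNReal.ofReal (1 - ∑ i, ‖z i‖ ^ 2) ^ a := by
      rw [← lintegral_indicator hb]
      congr 1
      ext z
      by_cases hz : z ∈ ball n
      · have hz' : ∑ i, ‖z i‖ ^ 2 < 1 := hz
        rw [Set.indicator_of_mem hz, ENNReal.ofReal_pow (by linarith)]
      · have hz' : ¬ ∑ i, ‖z i‖ ^ 2 < 1 := hz
        rw [Set.indicator_of_notMem hz, ENNReal.ofReal_of_nonpos (by linarith), zero_pow ha.ne']
    rw [this, lintegral_one_sub_norm_sq_pow n ha, ENNReal.toReal_ofReal (by positivity)]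
  · refine (ae_restrict_iff' hb).2 (Eventually.of_forall fun z hz => ?_)
    have hz' : ∑ i, ‖z i‖ ^ 2 < 1 := hz
    exact pow_nonneg (by linarith) _
  · exact Continuous.aestronglyMeasurable (by fun_prop)

theorem smul_mem_ball {u : ℂ} (hu : ‖u‖ ≤ 1) (hz : z ∈ ball n) : u • z ∈ ball n := by
  refine lt_of_le_of_lt (Finset.sum_le_sum fun i _ => ?_)
    (show ∑ i, ‖z i‖ ^ 2 < 1 from hz)
  rw [Pi.smul_apply, norm_smul]
  exact pow_le_pow_left₀ (by positivity) (mul_le_of_le_one_left (norm_nonneg _) hu) 2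

theorem sum_norm_sq_smul {u : ℂ} (hu : ‖u‖ = 1) (z : Fin n → ℂ) :
    ∑ i, ‖(u • z) i‖ ^ 2 = ∑ i, ‖z i‖ ^ 2 := by
  simp [hu]

theorem volume_ball_lt_top : volume (ball n) < ⊤ := by
  refine lt_of_le_of_lt (measure_mono fun z hz => ?_)
    (measure_closedBall_lt_top (x := (0 : Fin n → ℂ)) (r := 1))
  rw [mem_closedBall_zero_iff, pi_norm_le_iff_of_nonneg zero_le_one]
  intro i
  have h1 : ∑ i, ‖z i‖ ^ 2 < 1 := hz
  have h2 := Finset.single_le_sum (f := fun i => ‖z i‖ ^ 2) (fun i _ => by positivity)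
    (Finset.mem_univ i)
  nlinarith [norm_nonneg (z i)]

theorem measurePreserving_smul_of_norm_eq_one {u : ℂ} (hu : ‖u‖ = 1) :
    MeasurePreserving (fun z : Fin n → ℂ => u • z) := by
  have h (_ : Fin n) : MeasurePreserving (fun x : ℂ => u * x) := by
    have := (rotation ⟨u, mem_sphere_zero_iff_norm.2 hu⟩).measurePreserving
    convert! this using 1
  exact volume_preserving_pi h

theorem setIntegral_ball_smul {u : ℂ} (hu : ‖u‖ = 1) (f : (Fin n → ℂ) → ℂ) :
    ∫ z in ball n, f (u • z) = ∫ z in ball n, f z := by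
  have hu0 : u ≠ 0 := by
    rintro rfl
    simp at hu
  have h := (measurePreserving_smul_of_norm_eq_one (n := n) hu).setIntegral_preimage_emb
    (Homeomorph.smulOfNeZero u hu0).measurableEmbedding f (ball n)
  rw [← h]
  congr 2
  ext z
  simp only [ball, Set.mem_preimage, Set.mem_ofPred_eq, sum_norm_sq_smul hu]

/-- The mean value property of holomorphic functions on the ball, with respect to a
rotation-invariant weight. -/
theorem setIntegral_ball_mul_weight {h : (Fin n → ℂ) → ℂ} (hh : DifferentiableOn ℂ h (ball n))
    {ρ : (Fin n → ℂ) → ℝ} (hρ : ContinuousOn ρ (ball n))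
    (hrot : ∀ u : ℂ, ‖u‖ = 1 → ∀ z, ρ (u • z) = ρ z) {C : ℝ}
    (hC : ∀ z ∈ ball n, ‖h z * ρ z‖ ≤ C) :
    ∫ z in ball n, h z * ρ z = h 0 * ∫ z in ball n, ρ z := by
  have hb : MeasurableSet (ball n) := isOpen_ball.measurableSet
  have hfin : IsFiniteMeasure (volume.restrict (ball n)) :=
    isFiniteMeasure_restrict.2 volume_ball_lt_top.ne
  have hfin' : IsFiniteMeasure (volume.restrict (Set.uIoc 0 (2 * Real.pi))) :=
    isFiniteMeasure_restrict.2 measure_Ioc_lt_top.ne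
  have hcm (θ : ℝ) : ‖circleMap 0 1 θ‖ = 1 := by simp
  have hint : Integrable (Function.uncurry fun (θ : ℝ) (z : Fin n → ℂ) =>
      h (circleMap 0 1 θ • z) * ρ z)
      ((volume.restrict (Set.uIoc 0 (2 * Real.pi))).prod (volume.restrict (ball n))) := by
    have hcont : ContinuousOn (Function.uncurry fun (θ : ℝ) (z : Fin n → ℂ) =>
        h (circleMap 0 1 θ • z) * ρ z) (Set.uIoc 0 (2 * Real.pi) ×ˢ ball n) := by
      refine ContinuousOn.mul ?_ (Complex.continuous_ofReal.comp_continuousOn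
        (hρ.comp continuousOn_snd fun p hp => hp.2))
      refine hh.continuousOn.comp (f := fun p : ℝ × (Fin n → ℂ) => circleMap 0 1 p.1 • p.2) ?_
        fun p hp => smul_mem_ball (hcm _).le hp.2
      exact (((continuous_circleMap 0 1).comp continuous_fst).smul continuous_snd).continuousOn
    have hm : MeasurableSet (Set.uIoc 0 (2 * Real.pi) ×ˢ ball n) := measurableSet_uIoc.prod hb
    refine Integrable.of_bound (C := C) ?_ ?_
    · rw [Measure.prod_restrict]
      exact hcont.aestronglyMeasurable hm
    · rw [Measure.prod_restrict]
      refine (ae_restrict_iff' hm).2 (Eventually.of_forall fun p hp => ?_)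
      have := hC _ (smul_mem_ball (hcm p.1).le hp.2)
      rwa [hrot _ (hcm p.1)] at this
  have hswap := intervalIntegral_integral_swap hint
  have hleft (θ : ℝ) : ∫ z in ball n, h (circleMap 0 1 θ • z) * ρ z
      = ∫ z in ball n, h z * ρ z := by
    rw [← setIntegral_ball_smul (hcm θ) (fun z => h z * ρ z)]
    simp only [hrot _ (hcm θ)]
  have hright : ∀ z ∈ ball n, ∫ θ in 0..2 * Real.pi, h (circleMap 0 1 θ • z) * ρ z
      = (2 * Real.pi * h 0 : ℂ) * ρ z := by
    intro z hz
    have hd : DifferentiableOn ℂ (fun u : ℂ => h (u • z)) (Metric.closedBall 0 1) := by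
      refine hh.comp (f := fun u : ℂ => u • z) (by fun_prop) fun u hu => smul_mem_ball ?_ hz
      simpa using hu
    have havg := DiffContOnCl.circleAverage (f := fun u : ℂ => h (u • z)) (c := 0) (R := 1)
      (by simpa using (hd.diffContOnCl_ball (c := 0) (R := 1) subset_rfl))
    rw [Real.circleAverage_def, zero_smul, inv_smul_eq_iff₀ (by positivity)] at havg
    rw [intervalIntegral.integral_mul_const, havg]
    simp
  simp only [hleft] at hswap
  rw [setIntegral_congr_fun hb hright, intervalIntegral.integral_const, integral_const_mul,
    integral_complex_ofReal] at hswap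
  have hpi : (2 * Real.pi : ℂ) ≠ 0 := by simp [Real.pi_ne_zero]
  apply mul_left_cancel₀ hpi
  rw [← mul_assoc, ← hswap]
  simp

theorem Kr_pos (hz : z ∈ ball n) : 0 < Kr z := by
  have h : 0 < 1 - ∑ i, ‖z i‖ ^ 2 := sub_pos.2 hz
  have := Real.pi_pos
  unfold Kr
  positivity

theorem const_le_Kr (hz : z ∈ ball n) : (n.factorial : ℝ) / Real.pi ^ n ≤ Kr z := by
  have h : 0 < 1 - ∑ i, ‖z i‖ ^ 2 := sub_pos.2 hz
  have h2 : (0 : ℝ) ≤ ∑ i, ‖z i‖ ^ 2 := by positivity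
  have := Real.pi_pos
  exact le_mul_of_one_le_right (by positivity)
    (one_le_pow₀ ((one_le_inv₀ h).2 (by linarith)))

theorem continuousOn_Kr : ContinuousOn (Kr : (Fin n → ℂ) → ℝ) (ball n) := by
  unfold Kr
  refine continuousOn_const.mul (ContinuousOn.pow (ContinuousOn.inv₀ (by fun_prop) ?_) _)
  exact fun z hz => (sub_pos.2 hz).ne'

theorem norm_jac_sq_mul_Kr_act (h : IsPseudoUnitary A) (hz : z ∈ ball n) :
    ‖jac A z‖ ^ 2 * Kr (act A z) = Kr z := by
  have hd := norm_ne_zero_iff.2 (denom_ne_zero h hz)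
  have h2 : 0 < 1 - ∑ i, ‖act A z i‖ ^ 2 := sub_pos.2 (act_mem_ball h hz)
  rw [Kr, Kr, ← one_sub_act h hz, jac, norm_pow, norm_inv, mul_inv, mul_pow, ← inv_pow, ← pow_mul,
    ← pow_mul]
  ring

theorem Kc_act_mul_jac (h : IsPseudoUnitary A) (hz : z ∈ ball n) (hw : w ∈ ball n) :
    Kc (act A z) (act A w) * (jac A z * star (jac A w)) = Kc z w := by
  rw [Kc, Kc, ← pair_act h hz hw, jac, jac, star_pow, star_inv₀, ← mul_neg, mul_inv, mul_inv,
    mul_pow, mul_pow]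
  ring

theorem jac_ne_zero (h : IsPseudoUnitary A) (hz : z ∈ ball n) : jac A z ≠ 0 :=
  pow_ne_zero _ (inv_ne_zero (denom_ne_zero h hz))

theorem re_neg_pair_ge (hz : z ∈ ball n) :
    (1 - ∑ i, ‖w i‖ ^ 2) / 2 ≤ (-(pair z w)).re := by
  have h1 : ∑ i, ‖z i‖ ^ 2 < 1 := hz
  have h2 : (pair z w).re = ∑ i, (z i * star (w i)).re - 1 := by simp [pair]
  have h3 : ∑ i, (z i * star (w i)).re ≤ ∑ i, (‖z i‖ ^ 2 + ‖w i‖ ^ 2) / 2 := by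
    refine Finset.sum_le_sum fun i _ => ?_
    have h4 := Complex.re_le_norm (z i * star (w i))
    rw [norm_mul, norm_star] at h4
    nlinarith [sq_nonneg (‖z i‖ - ‖w i‖)]
  rw [← Finset.sum_div, Finset.sum_add_distrib] at h3
  rw [Complex.neg_re, h2]
  linarith

theorem pair_ne_zero (hz : z ∈ ball n) (hw : w ∈ ball n) : pair z w ≠ 0 := by
  intro h0
  have h1 := re_neg_pair_ge (w := w) hz
  have h2 : ∑ i, ‖w i‖ ^ 2 < 1 := hw
  rw [h0] at h1
  simp only [neg_zero, Complex.zero_re] at h1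
  linarith

theorem exists_norm_Kc_le (hw : w ∈ ball n) : ∃ C, ∀ z ∈ ball n, ‖Kc z w‖ ≤ C := by
  have h2 : 0 < (1 - ∑ i, ‖w i‖ ^ 2) / 2 := half_pos (sub_pos.2 hw)
  refine ⟨(n.factorial : ℝ) / Real.pi ^ n * ((1 - ∑ i, ‖w i‖ ^ 2) / 2)⁻¹ ^ (n + 1),
    fun z hz => ?_⟩
  have h3 := (re_neg_pair_ge (w := w) hz).trans (Complex.re_le_norm _)
  have := Real.pi_pos
  rw [Kc, norm_mul, Complex.norm_real, Real.norm_of_nonneg (by positivity), norm_pow, norm_inv]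
  gcongr

theorem continuousOn_Kc (hw : w ∈ ball n) : ContinuousOn (fun z => Kc z w) (ball n) := by
  unfold Kc
  refine continuousOn_const.mul (ContinuousOn.pow (ContinuousOn.inv₀ ?_ ?_) _)
  · unfold pair
    fun_prop
  · exact fun z hz => neg_ne_zero.2 (pair_ne_zero hz hw)

/-- Automorphic forms of weight `k` for a cocompact group satisfy `|f|² ≤ M · K(z,z)^k`. -/
theorem Htilde.exists_norm_sq_le {G : DiscreteGroup n} {k : ℕ} {g : (Fin n → ℂ) → ℂ}
    (hg : Htilde G k g) : ∃ M, ∀ z ∈ ball n, ‖g z‖ ^ 2 ≤ M * Kr z ^ k := by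
  obtain ⟨D, hDb, hDc, hD⟩ := G.cocompact
  have hcont : ContinuousOn (fun z => ‖g z‖ ^ 2 / Kr z ^ k) D := by
    refine ContinuousOn.div ((hg.1.continuousOn.mono hDb).norm.pow 2)
      ((continuousOn_Kr.mono hDb).pow k) fun z hz => pow_ne_zero _ (Kr_pos (hDb hz)).ne'
  obtain ⟨M, hM⟩ := (hDc.image_of_continuousOn hcont).bddAbove
  refine ⟨M, fun z hz => ?_⟩
  obtain ⟨A, hA, hAz⟩ := hD z hz
  have hU := isPseudoUnitary_of_mem_SU (G.sub_SU hA)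
  have h1 := hM ⟨_, hAz, rfl⟩
  simp only at h1
  rw [div_le_iff₀ (pow_pos (Kr_pos (hDb hAz)) k)] at h1
  rw [← hg.2 A hA z hz, norm_mul, norm_pow, ← norm_jac_sq_mul_Kr_act hU hz, mul_pow, mul_pow]
  calc ‖g (act A z)‖ ^ 2 * (‖jac A z‖ ^ k) ^ 2
      ≤ M * Kr (act A z) ^ k * (‖jac A z‖ ^ k) ^ 2 := by gcongr
    _ = M * ((‖jac A z‖ ^ 2) ^ k * Kr (act A z) ^ k) := by ring

theorem exists_norm_mul_Kr_zpow_le {k : ℕ} (hk : 2 ≤ k) {g : (Fin n → ℂ) → ℂ} {M : ℝ}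
    (hM : ∀ z ∈ ball n, ‖g z‖ ^ 2 ≤ M * Kr z ^ k) :
    ∃ C, ∀ z ∈ ball n, ‖g z * ((Kr z ^ ((1 : ℤ) - (k : ℤ)) : ℝ) : ℂ)‖ ≤ C := by
  obtain ⟨m, rfl⟩ := Nat.exists_eq_add_of_le' hk
  set κ : ℝ := (n.factorial : ℝ) / Real.pi ^ n
  have hκ : 0 < κ := by have := Real.pi_pos; positivity
  refine ⟨√(M * (κ ^ m)⁻¹), fun z hz => ?_⟩
  have hK := Kr_pos hz
  have hM0 : 0 ≤ M :=
    nonneg_of_mul_nonneg_left ((sq_nonneg _).trans (hM z hz)) (pow_pos hK _)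
  apply Real.le_sqrt_of_sq_le
  have he : (1 : ℤ) - ((m + 2 : ℕ) : ℤ) = -((m + 1 : ℕ) : ℤ) := by push_cast; ring
  rw [norm_mul, Complex.norm_real, Real.norm_of_nonneg (zpow_nonneg hK.le _), he, _root_.zpow_neg,
    zpow_natCast, mul_pow]
  calc ‖g z‖ ^ 2 * (Kr z ^ (m + 1))⁻¹ ^ 2
      ≤ M * Kr z ^ (m + 2) * (Kr z ^ (m + 1))⁻¹ ^ 2 := by gcongr; exact hM z hz
    _ = M * (Kr z ^ m)⁻¹ := by field_simp; ring
    _ ≤ M * (κ ^ m)⁻¹ := by gcongr; exact const_le_Kr hz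

/-- The integrand of the inner product of `g` with `K(·,w)^k` over the ball. -/
noncomputable def kernelIntegrand (k : ℕ) (g : (Fin n → ℂ) → ℂ) (w z : Fin n → ℂ) : ℂ :=
  g z * star (Kc z w ^ k) * ((Kr z ^ ((1 : ℤ) - (k : ℤ)) : ℝ) : ℂ)

theorem integrableOn_kernelIntegrand {k : ℕ} (hk : 2 ≤ k) {g : (Fin n → ℂ) → ℂ}
    (hg : ContinuousOn g (ball n)) {M : ℝ} (hM : ∀ z ∈ ball n, ‖g z‖ ^ 2 ≤ M * Kr z ^ k)
    (hw : w ∈ ball n) : IntegrableOn (kernelIntegrand k g w) (ball n) := by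
  have hb : MeasurableSet (ball n) := isOpen_ball.measurableSet
  have hfin : IsFiniteMeasure (volume.restrict (ball n)) :=
    isFiniteMeasure_restrict.2 volume_ball_lt_top.ne
  obtain ⟨C, hC⟩ := exists_norm_mul_Kr_zpow_le hk hM
  obtain ⟨C', hC'⟩ := exists_norm_Kc_le hw
  refine Integrable.of_bound (C := C * C' ^ k) ?_ ?_
  · refine ContinuousOn.aestronglyMeasurable ?_ hb
    refine (hg.mul ((continuousOn_Kc hw).pow k).star).mul
      (Complex.continuous_ofReal.comp_continuousOn ?_)
    exact continuousOn_Kr.zpow₀ _ fun z hz => Or.inl (Kr_pos hz).ne'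
  · refine (ae_restrict_iff' hb).2 (Eventually.of_forall fun z hz => ?_)
    rw [kernelIntegrand, mul_right_comm, norm_mul, norm_star, norm_pow]
    have h1 := hC z hz
    have h2 := hC' z hz
    have h3 := (norm_nonneg _).trans h1
    gcongr

theorem norm_jac_sq_smul_kernelIntegrand_act (h : IsPseudoUnitary A) (hz : z ∈ ball n) {k : ℕ}
    (g : (Fin n → ℂ) → ℂ) (w : Fin n → ℂ) :
    ‖jac A z‖ ^ 2 • kernelIntegrand k g w (act A z) =
      g (act A z) * jac A z ^ k * star (Kc (act A z) w ^ k * jac A z ^ k) *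
        ((Kr z ^ ((1 : ℤ) - (k : ℤ)) : ℝ) : ℂ) := by
  have hj : (‖jac A z‖ ^ 2 : ℝ) ≠ 0 := pow_ne_zero _ (norm_ne_zero_iff.2 (jac_ne_zero h hz))
  have h1 : (‖jac A z‖ ^ 2 : ℝ) * Kr (act A z) ^ ((1 : ℤ) - (k : ℤ))
      = (‖jac A z‖ ^ 2) ^ k * Kr z ^ ((1 : ℤ) - (k : ℤ)) := by
    rw [← norm_jac_sq_mul_Kr_act h hz, mul_zpow, ← mul_assoc, ← zpow_natCast (‖jac A z‖ ^ 2) k,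
      ← zpow_add₀ hj, add_sub_cancel, zpow_one]
  have h2 : jac A z ^ k * star (jac A z ^ k) = (((‖jac A z‖ ^ 2) ^ k : ℝ) : ℂ) := by
    rw [star_pow, ← mul_pow, Complex.star_def, Complex.mul_conj, Complex.normSq_eq_norm_sq]
    push_cast
    rfl
  have h3 := congrArg (fun x : ℝ => (x : ℂ)) h1
  simp only [Complex.ofReal_mul] at h3
  rw [kernelIntegrand, Complex.real_smul, star_mul']
  calc _ = g (act A z) * star (Kc (act A z) w ^ k) * (((‖jac A z‖ ^ 2 : ℝ) : ℂ) *
        ((Kr (act A z) ^ ((1 : ℤ) - (k : ℤ)) : ℝ) : ℂ)) := by ring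
    _ = _ := by rw [h3, ← h2]; ring

theorem cB_mul_setIntegral_Kr_zpow (n : ℕ) {k : ℕ} (hk : 2 ≤ k) :
    (cB n k : ℝ) * (((n.factorial : ℝ) / Real.pi ^ n) ^ k *
      ∫ z in ball n, Kr z ^ ((1 : ℤ) - (k : ℤ))) = 1 := by
  obtain ⟨m, rfl⟩ := Nat.exists_eq_add_of_le' (one_le_two.trans hk)
  have hm : 0 < m := by omega
  set κ : ℝ := (n.factorial : ℝ) / Real.pi ^ n with hκ
  have hκ0 : 0 < κ := by have := Real.pi_pos; positivity
  have he : (1 : ℤ) - ((m + 1 : ℕ) : ℤ) = -(m : ℤ) := by push_cast; ring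
  have h1 (z : Fin n → ℂ) : Kr z ^ ((1 : ℤ) - ((m + 1 : ℕ) : ℤ))
      = (κ ^ m)⁻¹ * (1 - ∑ i, ‖z i‖ ^ 2) ^ ((n + 1) * m) := by
    rw [he, _root_.zpow_neg, zpow_natCast, Kr, mul_pow, mul_inv, inv_pow, inv_pow, inv_inv, ← pow_mul]
  simp only [h1]
  rw [integral_const_mul, setIntegral_ball_one_sub_norm_sq_pow n (by positivity)]
  set a := (n + 1) * m
  have hc : cB n (m + 1) = (n + a).choose n := by
    rw [cB, Nat.add_sub_cancel, add_comm]
  have h2 : ((n + a).choose n : ℝ) * (n.factorial * a.factorial) = (n + a).factorial := by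
    have := Nat.add_choose_mul_factorial_mul_factorial n a
    rw [Nat.choose_symm_add, ← mul_assoc]
    exact_mod_cast this
  have hpi := Real.pi_pos
  have h3 : κ * (Real.pi ^ n * a.factorial / (n + a).factorial)
      = n.factorial * a.factorial / (n + a).factorial := by
    rw [hκ]
    field_simp
  have h4 : κ ^ (m + 1) * ((κ ^ m)⁻¹ * (Real.pi ^ n * a.factorial / (n + a).factorial))
      = κ * (Real.pi ^ n * a.factorial / (n + a).factorial) := by
    rw [pow_succ]
    field_simp
  rw [h4, h3, hc, ← mul_div_assoc, h2, div_self (by positivity)]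

theorem Kc_zero (z : Fin n → ℂ) :
    Kc z 0 = (((n.factorial : ℝ) / Real.pi ^ n : ℝ) : ℂ) := by
  simp [Kc, pair]

/-- The reproducing property of the weighted Bergman kernel of the ball. -/
theorem setIntegral_kernelIntegrand {k : ℕ} (hk : 2 ≤ k) {g : (Fin n → ℂ) → ℂ}
    (hg : DifferentiableOn ℂ g (ball n)) {M : ℝ} (hM : ∀ z ∈ ball n, ‖g z‖ ^ 2 ≤ M * Kr z ^ k)
    (hw : w ∈ ball n) : (cB n k : ℂ) * ∫ z in ball n, kernelIntegrand k g w z = g w := by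
  have hb : MeasurableSet (ball n) := isOpen_ball.measurableSet
  obtain ⟨A, hA, rfl⟩ := exists_act_zero_eq hw
  have h0 : (0 : Fin n → ℂ) ∈ ball n := zero_mem_ball
  have hj0 := jac_ne_zero hA h0
  set κ : ℝ := (n.factorial : ℝ) / Real.pi ^ n
  let h : (Fin n → ℂ) → ℂ := fun z => g (act A z) * jac A z ^ k
  have hjac : DifferentiableOn ℂ (jac A) (ball n) := by
    unfold jac
    refine DifferentiableOn.pow (DifferentiableOn.inv ?_ fun z hz => denom_ne_zero hA hz) _
    unfold denom
    fun_prop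
  have hh : DifferentiableOn ℂ h (ball n) :=
    (hg.comp (differentiableOn_act hA) fun z hz => act_mem_ball hA hz).mul (hjac.pow k)
  have hhM : ∀ z ∈ ball n, ‖h z‖ ^ 2 ≤ M * Kr z ^ k := by
    intro z hz
    rw [norm_mul, norm_pow, ← norm_jac_sq_mul_Kr_act hA hz, mul_pow, mul_pow]
    calc ‖g (act A z)‖ ^ 2 * (‖jac A z‖ ^ k) ^ 2
        ≤ M * Kr (act A z) ^ k * (‖jac A z‖ ^ k) ^ 2 := by
          gcongr
          exact hM _ (act_mem_ball hA hz)
      _ = M * ((‖jac A z‖ ^ 2) ^ k * Kr (act A z) ^ k) := by ring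
  obtain ⟨C, hC⟩ := exists_norm_mul_Kr_zpow_le hk hhM
  have hmean := setIntegral_ball_mul_weight (ρ := fun z => Kr z ^ ((1 : ℤ) - (k : ℤ))) hh
    (continuousOn_Kr.zpow₀ _ fun z hz => Or.inl (Kr_pos hz).ne')
    (fun u hu z => by simp only [Kr, sum_norm_sq_smul hu]) hC
  have hint : ∫ z in ball n, kernelIntegrand k g (act A 0) z
      = star ((κ / star (jac A 0)) ^ k) *
        ∫ z in ball n, h z * ((Kr z ^ ((1 : ℤ) - (k : ℤ)) : ℝ) : ℂ) := by
    conv_lhs => rw [← image_act_ball hA]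
    rw [setIntegral_image_act hA subset_rfl hb, ← integral_const_mul]
    refine setIntegral_congr_fun hb fun z hz => ?_
    have h1 : Kc (act A z) (act A 0) * jac A z = κ / star (jac A 0) := by
      rw [eq_div_iff (star_ne_zero.2 hj0), mul_assoc, Kc_act_mul_jac hA hz h0, Kc_zero]
    rw [norm_jac_sq_smul_kernelIntegrand_act hA hz, ← mul_pow, h1]
    ring
  have hnorm := congrArg (fun x : ℝ => (x : ℂ)) (cB_mul_setIntegral_Kr_zpow n hk)
  simp only [Complex.ofReal_mul, Complex.ofReal_pow, Complex.ofReal_natCast,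
    Complex.ofReal_one] at hnorm
  have hstar : star ((κ / star (jac A 0)) ^ k) * jac A 0 ^ k = (κ : ℂ) ^ k := by
    rw [star_pow, star_div₀, star_star, ← mul_pow, Complex.star_def, Complex.conj_ofReal,
      div_mul_cancel₀ _ hj0]
  rw [hint, hmean]
  calc _ = g (act A 0) * ((cB n k : ℂ) * ((star ((κ / star (jac A 0)) ^ k) * jac A 0 ^ k) *
        ((∫ z in ball n, Kr z ^ ((1 : ℤ) - (k : ℤ)) : ℝ) : ℂ))) := by simp only [h]; ring
    _ = g (act A 0) := by rw [hstar, hnorm, mul_one]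

theorem DiscreteGroup.isPseudoUnitary (G : DiscreteGroup n) (A : ↥G.Γ) :
    IsPseudoUnitary (A : Matrix (Fin (n + 1)) (Fin (n + 1)) ℂ) :=
  isPseudoUnitary_of_mem_SU (G.sub_SU A.2)

theorem DiscreteGroup.countable (G : DiscreteGroup n) : Countable ↥G.Γ := by
  have := G.discrete
  have : SecondCountableTopology (Matrix (Fin (n + 1)) (Fin (n + 1)) ℂ) :=
    inferInstanceAs (SecondCountableTopology (Fin (n + 1) → Fin (n + 1) → ℂ))
  exact TopologicalSpace.separableSpace_iff_countable.1 inferInstance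

theorem IsFundDom.iUnion_image_act {G : DiscreteGroup n} {F : Set (Fin n → ℂ)}
    (hF : IsFundDom G F) :
    ⋃ A : ↥G.Γ, act (A : Matrix (Fin (n + 1)) (Fin (n + 1)) ℂ) '' F = ball n := by
  refine Set.Subset.antisymm (Set.iUnion_subset fun A => ?_) fun z hz => ?_
  · rintro _ ⟨z, hz, rfl⟩
    exact act_mem_ball (G.isPseudoUnitary A) (hF.1 hz)
  · obtain ⟨A, hA, hAz⟩ := hF.2.2.1 z hz
    exact Set.mem_iUnion.2 ⟨⟨A⁻¹, G.inv_mem hA⟩, act A z, hAz,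
      act_inv_act (G.isPseudoUnitary ⟨A, hA⟩) hz⟩

theorem IsFundDom.pairwise_aedisjoint_image_act {G : DiscreteGroup n} {F : Set (Fin n → ℂ)}
    (hF : IsFundDom G F) :
    Pairwise (Function.onFun (AEDisjoint volume)
      fun A : ↥G.Γ => act (A : Matrix (Fin (n + 1)) (Fin (n + 1)) ℂ) '' F) := by
  intro A B hAB
  have hA := G.isPseudoUnitary A
  have hB := G.isPseudoUnitary B
  have hne : (B : Matrix (Fin (n + 1)) (Fin (n + 1)) ℂ)⁻¹ * A ≠ 1 := by
    intro h
    apply hAB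
    apply Subtype.ext
    rw [← one_mul A.1, ← Matrix.mul_nonsing_inv _ hB.isUnit_det, mul_assoc, h, mul_one]
  have h0 := hF.2.2.2 _ (G.mul_mem (G.inv_mem B.2) A.2) hne
  refine measure_mono_null ?_ (volume_image_act_eq_zero hA (fun z hz => hF.1 hz.1) h0)
  rintro _ ⟨⟨z, hz, rfl⟩, y, hy, hyz⟩
  refine ⟨z, ⟨hz, ?_⟩, rfl⟩
  rw [act_mul hA (hF.1 hz), ← hyz, act_inv_act hB (hF.1 hy)]
  exact hy

/-- The integrals of the `Γ`-translates of a function over a fundamental domain add up to its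
integral over the ball. -/
theorem IsFundDom.integral_tsum_smul_comp_act {G : DiscreteGroup n} {F : Set (Fin n → ℂ)}
    (hF : IsFundDom G F) {f : (Fin n → ℂ) → ℂ} (hf : IntegrableOn f (ball n)) :
    ∫ z in F, ∑' A : ↥G.Γ, ‖jac (A : Matrix (Fin (n + 1)) (Fin (n + 1)) ℂ) z‖ ^ 2 •
      f (act (A : Matrix (Fin (n + 1)) (Fin (n + 1)) ℂ) z) = ∫ z in ball n, f z := by
  have := G.countable
  have hU := hF.iUnion_image_act
  have hm (A : ↥G.Γ) := (measurableSet_image_act (G.isPseudoUnitary A) hF.1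
    hF.2.1).nullMeasurableSet (μ := volume)
  rw [← hU] at hf ⊢
  have h1 := hasSum_integral_iUnion_ae hm hF.pairwise_aedisjoint_image_act hf
  have h2 := (hasSum_integral_iUnion_ae hm hF.pairwise_aedisjoint_image_act hf.norm).summable
  have hint (A : ↥G.Γ) := (integrableOn_image_act (G.isPseudoUnitary A) hF.1 hF.2.1 f).1
    (hf.mono_set (Set.subset_iUnion
      (fun A : ↥G.Γ => act (A : Matrix (Fin (n + 1)) (Fin (n + 1)) ℂ) '' F) A))
  simp only [setIntegral_image_act (G.isPseudoUnitary _) hF.1 hF.2.1] at h1 h2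
  refine (hasSum_integral_of_summable_integral_norm hint ?_).unique h1
  simpa only [norm_smul, norm_pow, norm_norm, smul_eq_mul] using h2

theorem iprod_ThetaPt_eq {G : DiscreteGroup n} {F : Set (Fin n → ℂ)} (hF : IsFundDom G F) {k : ℕ}
    {g : (Fin n → ℂ) → ℂ} (hg : Automorphic G k g) (w : Fin n → ℂ) :
    iprod F k g (ThetaPt G k w) = (cB n k : ℂ) * ∫ z in F, ∑' A : ↥G.Γ,
      ‖jac (A : Matrix (Fin (n + 1)) (Fin (n + 1)) ℂ) z‖ ^ 2 •
        kernelIntegrand k g w (act (A : Matrix (Fin (n + 1)) (Fin (n + 1)) ℂ) z) := by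
  rw [iprod, ← integral_const_mul]
  refine setIntegral_congr_fun hF.2.1 fun z hz => ?_
  have h (A : ↥G.Γ) := norm_jac_sq_smul_kernelIntegrand_act (k := k) (G.isPseudoUnitary A)
    (hF.1 hz) g w
  simp only [h, hg _ (Subtype.coe_prop _) z (hF.1 hz)]
  rw [tsum_mul_right, tsum_mul_left, ThetaPt, star_mul', tsum_star, star_natCast]
  ring

end BallPaper

open BallPaper in
/-- for g ∈ H̃⁰_Γ(k) and w ∈ 𝔹ⁿ, (g, Θ_w^{(k)}) = g(w). -/
theorem iprod_ThetaPt (n : ℕ) (G : BallPaper.DiscreteGroup n)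
    (F : Set (Fin n → ℂ)) (hF : IsFundDom G F) (k : ℕ) (hk : 2 ≤ k)
    (g : (Fin n → ℂ) → ℂ) (hg : Htilde G k g) (w : Fin n → ℂ) (hw : w ∈ ball n) :
    iprod F k g (ThetaPt G k w) = g w := by
  obtain ⟨M, hM⟩ := hg.exists_norm_sq_le
  rw [iprod_ThetaPt_eq hF hg.2, hF.integral_tsum_smul_comp_act
    (integrableOn_kernelIntegrand hk hg.1.continuousOn hM hw),
    setIntegral_kernelIntegrand hk hg.1 hM hw]
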